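/- arXiv:2205.11847 — 2 statements merged into one kernel-verified Lean document; each statement's English description precedes it below -/
import Mathlib

section
/- Assume there is λ* > 0 with λ_k ≥ λ* for every k, that 1 − e^{-2Tλ*} ≥ 1/2, and that a_k ≠ 0 for at least one k. Then for every 0 < ε < T, the ratio (∫_ε^T ‖w(t)‖² dt) / (∫₀^T ‖w(t)‖² dt) is at most 2 e^{-2ελ*}. In particular, for the normalized measure ν = ‖w(t)‖² dt / ∫₀^T ‖w(s)‖² ds on [0,T], the mass of [ε,T] tends to 0 as λ* → ∞. -/
open MeasureTheory Filter Real

/-- Parseval's identity for the sum of a convergent series along an orthonormal family. -/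
theorem Orthonormal.hasSum_sq_norm_of_hasSum {ι H : Type*} [NormedAddCommGroup H]
    [InnerProductSpace ℝ H] {φ : ι → H} (hφ : Orthonormal ℝ φ) {c : ι → ℝ} {x : H}
    (hx : HasSum (fun k => c k • φ k) x) : HasSum (fun k => c k ^ 2) (‖x‖ ^ 2) := by
  classical
  have hcoeff (j : ι) : inner ℝ x (φ j) = c j := by
    have h₁ : HasSum (fun k => inner ℝ (φ j) (c k • φ k)) (inner ℝ (φ j) x) :=
      (innerSL ℝ (φ j)).hasSum hx
    have h₂ : HasSum (fun k => inner ℝ (φ j) (c k • φ k)) (inner ℝ (φ j) (c j • φ j)) := by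
      refine hasSum_single j fun k hk => ?_
      rw [real_inner_smul_right, hφ.inner_eq_zero hk.symm, mul_zero]
    rw [real_inner_comm, h₁.unique h₂, real_inner_smul_right, real_inner_self_eq_norm_sq,
      hφ.norm_eq_one, one_pow, mul_one]
  have h : HasSum (fun k => inner ℝ x (c k • φ k)) (inner ℝ x x) := (innerSL ℝ x).hasSum hx
  simpa only [real_inner_smul_right, hcoeff, real_inner_self_eq_norm_sq, ← pow_two] using h

/-- The squared norm of a superposition of modes with decay rates at least `μ` decays at rate
at least `2 * μ`. -/
theorem Orthonormal.sq_norm_add_le_exp_mul {ι H : Type*} [NormedAddCommGroup H]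
    [InnerProductSpace ℝ H] {φ : ι → H} (hφ : Orthonormal ℝ φ) {a lam : ι → ℝ} {w : ℝ → H}
    (hw : ∀ t : ℝ, 0 ≤ t → HasSum (fun k => (a k * Real.exp (-(lam k) * t)) • φ k) (w t))
    {μ : ℝ} (hμ : ∀ k, μ ≤ lam k) {s t : ℝ} (hs : 0 ≤ s) (ht : 0 ≤ t) :
    ‖w (t + s)‖ ^ 2 ≤ Real.exp (-2 * s * μ) * ‖w t‖ ^ 2 := by
  refine hasSum_le (fun k => ?_) (hφ.hasSum_sq_norm_of_hasSum (hw (t + s) (add_nonneg ht hs)))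
    ((hφ.hasSum_sq_norm_of_hasSum (hw t ht)).mul_left _)
  have h : (a k * Real.exp (-(lam k) * (t + s))) ^ 2
      = Real.exp (-2 * s * lam k) * (a k * Real.exp (-(lam k) * t)) ^ 2 := by
    have h₁ : Real.exp (-(lam k) * (t + s))
        = Real.exp (-(lam k) * t) * Real.exp (-(lam k) * s) := by
      rw [← Real.exp_add]; ring_nf
    have h₂ : Real.exp (-2 * s * lam k) = Real.exp (-(lam k) * s) ^ 2 := by
      rw [← Real.exp_nat_mul]; push_cast; ring_nf
    rw [h₁, h₂]; ring
  rw [h]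
  refine mul_le_mul_of_nonneg_right (Real.exp_le_exp.2 ?_) (sq_nonneg _)
  nlinarith [mul_le_mul_of_nonneg_left (hμ k) hs]

/-- **Quantitative time-concentration (Lemma 9 with zero potential).**
With `w(t) = Σ_k a_k e^(-λ_k t) φ_k`, if `λ_k ≥ λ* > 0` for every `k`,
`1 − e^(-2Tλ*) ≥ 1/2`, and `a_k ≠ 0` for at least one `k`, then for every
`0 < ε < T` the ratio `(∫_ε^T ‖w(t)‖² dt) / (∫₀^T ‖w(t)‖² dt)` is at most
`2 e^(-2ελ*)`; hence the normalized measure `ν = ‖w(t)‖² dt / ∫₀^T ‖w‖²`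
puts mass at most `2 e^(-2ελ*)` on `[ε, T]`, which tends to `0` as `λ* → ∞`. -/
theorem time_concentration_ratio {H : Type*} [NormedAddCommGroup H] [InnerProductSpace ℝ H]
    (φ : ℕ → H) (hφ : Orthonormal ℝ φ)
    (lam : ℕ → ℝ) (hlam : ∀ k, 0 < lam k)
    (a : ℕ → ℝ) (ha : Summable fun k => (a k) ^ 2)
    (T : ℝ) (hT : 0 < T)
    (w : ℝ → H)
    (hw : ∀ t : ℝ, 0 ≤ t → HasSum (fun k => (a k * Real.exp (-(lam k) * t)) • φ k) (w t))
    (lamstar : ℝ) (hls : 0 < lamstar) (hlb : ∀ k, lamstar ≤ lam k)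
    (hbig : 1 - Real.exp (-2 * T * lamstar) ≥ 1 / 2)
    (hne : ∃ k, a k ≠ 0)
    (ε : ℝ) (hε : 0 < ε) (hεT : ε < T) :
    (∫ t in Set.Ioo ε T, ‖w t‖ ^ 2) / (∫ t in Set.Ioo (0:ℝ) T, ‖w t‖ ^ 2)
      ≤ 2 * Real.exp (-2 * ε * lamstar) := by
  have hdecay {s t : ℝ} (hs : 0 ≤ s) (ht : 0 ≤ t) := hφ.sq_norm_add_le_exp_mul hw hlb hs ht
  have hanti : AntitoneOn (fun t => ‖w t‖ ^ 2) (Set.Icc 0 T) := by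
    intro s hs t _ hst
    have h := hdecay (sub_nonneg.2 hst) hs.1
    rw [add_sub_cancel] at h
    refine h.trans (mul_le_of_le_one_left (sq_nonneg _) (Real.exp_le_one_iff.2 ?_))
    nlinarith [mul_nonneg (sub_nonneg.2 hst) hls.le]
  have hint : IntegrableOn (fun t => ‖w t‖ ^ 2) (Set.Icc 0 T) :=
    hanti.integrableOn_isCompact isCompact_Icc
  have hle : ∫ t in Set.Ioo ε T, ‖w t‖ ^ 2
      ≤ Real.exp (-2 * ε * lamstar) * ∫ t in Set.Ioo (0:ℝ) T, ‖w t‖ ^ 2 := by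
    have hshift : ∫ t in Set.Ioo ε T, ‖w t‖ ^ 2 = ∫ t in Set.Ioo 0 (T - ε), ‖w (t + ε)‖ ^ 2 := by
      have h := (measurePreserving_add_right volume ε).setIntegral_preimage_emb
        (measurableEmbedding_addRight ε) (fun t => ‖w t‖ ^ 2) (Set.Ioo ε T)
      rwa [Set.preimage_add_const_Ioo, sub_self, eq_comm] at h
    have hsub : Set.Ioo 0 (T - ε) ⊆ Set.Ioo 0 T := Set.Ioo_subset_Ioo_right (by linarith)
    have hint' : IntegrableOn (fun t => ‖w t‖ ^ 2) (Set.Ioo 0 T) :=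
      hint.mono_set Set.Ioo_subset_Icc_self
    calc ∫ t in Set.Ioo ε T, ‖w t‖ ^ 2
        = ∫ t in Set.Ioo 0 (T - ε), ‖w (t + ε)‖ ^ 2 := hshift
      _ ≤ ∫ t in Set.Ioo 0 (T - ε), Real.exp (-2 * ε * lamstar) * ‖w t‖ ^ 2 := by
        refine integral_mono_of_nonneg (ae_of_all _ fun t => sq_nonneg _)
          ((hint'.mono_set hsub).const_mul _) ?_
        filter_upwards [ae_restrict_mem measurableSet_Ioo] with t ht
        exact hdecay hε.le ht.1.le
      _ = Real.exp (-2 * ε * lamstar) * ∫ t in Set.Ioo 0 (T - ε), ‖w t‖ ^ 2 :=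
        integral_const_mul _ _
      _ ≤ _ := by
        refine mul_le_mul_of_nonneg_left ?_ (Real.exp_pos _).le
        exact setIntegral_mono_set hint' (ae_of_all _ fun t => sq_nonneg _)
          hsub.eventuallyLE
  refine (div_le_of_le_mul₀ (integral_nonneg fun t => sq_nonneg _) (Real.exp_pos _).le
    hle).trans ?_
  linarith [Real.exp_pos (-2 * ε * lamstar)]
end

section
/- Let T > 0, let θ : ℝ → ℝ be continuous and 2π-periodic, and let φ : [0,T] × ℝ → ℝ be continuous and 2π-periodic in its second variable. Then, as the integer K tends to ∞, K² · ∫₀^T ∫₀^{2π} θ(x)² sin(Kx)² e^{-2K² t} φ(t,x) dx dt → (1/4) · ∫₀^{2π} θ(x)² φ(0,x) dx. -/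
open MeasureTheory Filter Real

/-- The Riemann-Lebesgue lemma for cosines on a bounded interval. -/
lemma tendsto_intervalIntegral_mul_cos_atTop {a b : ℝ} (hab : a ≤ b) {g : ℝ → ℝ}
    (hg : IntervalIntegrable g volume a b) :
    Tendsto (fun w : ℝ => ∫ x in a..b, g x * Real.cos (w * x)) atTop (nhds 0) := by
  have hscale : Tendsto (fun w : ℝ => w / (2 * π)) atTop (cocompact ℝ) :=
    (tendsto_id.atTop_div_const (by positivity)).mono_right atTop_le_cocompact
  have hre := (Complex.continuous_re.tendsto 0).comp
    ((Real.tendsto_integral_exp_smul_cocompact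
      ((Set.Ioc a b).indicator fun x => (g x : ℂ))).comp hscale)
  refine hre.congr fun w => ?_
  have hg' : IntegrableOn (fun x => (g x : ℂ)) (Set.Ioc a b) :=
    ((intervalIntegrable_iff_integrableOn_Ioc_of_le hab).1 hg).ofReal
  have hint : Integrable fun v : ℝ => fourierChar (-(v * (w / (2 * π)))) •
      (Set.Ioc a b).indicator (fun x => (g x : ℂ)) v := by
    simpa [mul_comm] using
      (Real.fourierIntegral_convergent_iff (μ := volume) (w / (2 * π))).2
        (hg'.integrable_indicator measurableSet_Ioc)
  simp only [Function.comp_apply]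
  rw [intervalIntegral.integral_of_le hab, ← integral_indicator measurableSet_Ioc]
  refine (Complex.reCLM.integral_comp_comm hint).symm.trans (integral_congr_ae ?_)
  refine ae_of_all _ fun x => ?_
  by_cases hx : x ∈ Set.Ioc a b
  · have hangle : 2 * π * -(x * (w / (2 * π))) = -(w * x) := by
      field_simp
    simp only [Set.indicator_of_mem hx, Circle.smul_def, Real.fourierChar_apply', hangle,
      Circle.coe_exp, smul_eq_mul, Complex.reCLM_apply, Complex.re_mul_ofReal,
      Complex.exp_ofReal_mul_I_re, Real.cos_neg]
    ring
  · simp [hx]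

/-- Laplace asymptotics at an endpoint where the phase is linear. -/
lemma tendsto_mul_integral_exp_neg_mul {T : ℝ} (hT : 0 < T) {f : ℝ → ℝ}
    (hf : ContinuousOn f (Set.Icc 0 T)) :
    Tendsto (fun r : ℝ => r * ∫ t in (0:ℝ)..T, Real.exp (-r * t) * f t) atTop (nhds (f 0)) := by
  have hdecay : ∀ c : ℝ, 0 < c → Tendsto (fun r : ℝ => r * Real.exp (-r * c)) atTop (nhds 0) := by
    intro c hc
    simpa [mul_comm] using tendsto_rpow_mul_exp_neg_mul_atTop_nhds_zero 1 c hc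
  have h := tendsto_setIntegral_peak_smul_of_integrableOn_of_tendsto (μ := volume)
    (φ := fun r t : ℝ => r * Real.exp (-r * t)) (l := atTop) (s := Set.Icc 0 T)
    (t := Set.Icc 0 T) (x₀ := 0) (g := f) (a := f 0) measurableSet_Icc measurableSet_Icc
    subset_rfl self_mem_nhdsWithin measure_Icc_lt_top.ne ?_ ?_ ?_ ?_
    (hf.integrableOn_compact isCompact_Icc) (hf 0 (Set.left_mem_Icc.2 hT.le))
  · refine h.congr fun r => ?_
    rw [intervalIntegral.integral_of_le hT.le, integral_Icc_eq_integral_Ioc,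
      ← integral_const_mul]
    simp only [smul_eq_mul, mul_assoc]
  · filter_upwards [eventually_ge_atTop 0] with r hr t _
    positivity
  · intro u hu h0
    obtain ⟨ε, hε, hball⟩ := Metric.isOpen_iff.1 hu 0 h0
    rw [Metric.tendstoUniformlyOn_iff]
    intro δ hδ
    filter_upwards [(hdecay ε hε).eventually (gt_mem_nhds hδ), eventually_ge_atTop 0]
      with r hr hr0 t ht
    have hεt : ε ≤ t := by
      by_contra! hlt
      exact ht.2 (hball (by simpa [abs_of_nonneg ht.1.1] using hlt))
    rw [Pi.zero_apply, dist_zero_left, Real.norm_eq_abs, abs_of_nonneg (by positivity)]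
    refine lt_of_le_of_lt ?_ hr
    gcongr ?_ * Real.exp ?_
    nlinarith
  · have h1 : Tendsto (fun r : ℝ => 1 - Real.exp (-r * T)) atTop (nhds 1) := by
      have : Tendsto (fun r : ℝ => Real.exp (-r * T)) atTop (nhds 0) :=
        Real.tendsto_exp_atBot.comp (tendsto_neg_atTop_atBot.atBot_mul_const hT)
      simpa using this.const_sub 1
    refine h1.congr' ?_
    filter_upwards [eventually_gt_atTop 0] with r hr
    rw [integral_Icc_eq_integral_Ioc, ← intervalIntegral.integral_of_le hT.le,
      intervalIntegral.integral_eq_sub_of_hasDerivAt (f := fun t => -Real.exp (-r * t))]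
    · simp
      ring
    · intro t _
      refine (((hasDerivAt_id t).const_mul (-r)).exp).neg.congr_deriv ?_
      simp [mul_comm]
    · exact (by fun_prop : Continuous fun t => r * Real.exp (-r * t)).intervalIntegrable _ _
  · exact Eventually.of_forall fun r =>
      (by fun_prop : Continuous fun t => r * Real.exp (-r * t)).aestronglyMeasurable

/-- The weak limit of `sin (K x) ^ 2` is its mean `1 / 2`. -/
lemma tendsto_intervalIntegral_mul_sin_sq {a b : ℝ} (hab : a ≤ b) {g : ℝ → ℝ}
    (hg : IntervalIntegrable g volume a b) :
    Tendsto (fun w : ℝ => ∫ x in a..b, g x * Real.sin (w * x) ^ 2) atTop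
      (nhds ((1 / 2) * ∫ x in a..b, g x)) := by
  have hcos := (tendsto_intervalIntegral_mul_cos_atTop hab hg).comp
    (tendsto_id.const_mul_atTop (two_pos (α := ℝ)))
  have h := (hcos.const_sub (∫ x in a..b, g x)).const_mul (1 / 2)
  rw [sub_zero] at h
  refine h.congr fun w => ?_
  have hgc : IntervalIntegrable (fun x => g x * Real.cos (2 * w * x)) volume a b :=
    hg.mul_continuousOn (by fun_prop)
  simp only [Function.comp_apply, id]
  rw [← intervalIntegral.integral_sub hg hgc, ← intervalIntegral.integral_const_mul]
  congr 1 with x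
  rw [Real.sin_sq_eq_half_sub, ← mul_assoc 2 w x]
  ring

/-- Two-scale Laplace asymptotics: a decaying exponential in `t` concentrates at `t = 0`, while
the squared oscillation in `x` averages to `1 / 2`. -/
lemma tendsto_sq_mul_integral_exp_mul_sin_sq {T : ℝ} (hT : 0 < T) {a b : ℝ} (hab : a ≤ b)
    {f : ℝ → ℝ → ℝ} (hf : Continuous fun p : ℝ × ℝ => f p.1 p.2) :
    Tendsto (fun w : ℝ => w ^ 2 * ∫ t in (0:ℝ)..T,
        Real.exp (-(2 * w ^ 2) * t) * ∫ x in a..b, f t x * Real.sin (w * x) ^ 2)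
      atTop (nhds ((1 / 4) * ∫ x in a..b, f 0 x)) := by
  have hft : ∀ t, Continuous (f t) := fun t => hf.comp (Continuous.prodMk_right t)
  set G : ℝ → ℝ → ℝ := fun w t => ∫ x in a..b, f t x * Real.sin (w * x) ^ 2 with hG
  set D : ℝ → ℝ := fun t => ∫ x in a..b, |f t x - f 0 x| with hD
  have hGc : ∀ w, Continuous (G w) := fun w =>
    intervalIntegral.continuous_parametric_intervalIntegral_of_continuous'
      (f := fun t x => f t x * Real.sin (w * x) ^ 2)
      (hf.mul (by fun_prop)) a b
  have hf0 : Continuous fun p : ℝ × ℝ => f 0 p.2 := (hft 0).comp continuous_snd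
  have hDc : Continuous D :=
    intervalIntegral.continuous_parametric_intervalIntegral_of_continuous'
      (f := fun t x => |f t x - f 0 x|) (hf.sub hf0).abs a b
  have hGD : ∀ w t, |G w t - G w 0| ≤ D t := by
    intro w t
    have hs : Continuous fun x => Real.sin (w * x) ^ 2 := by fun_prop
    rw [hG, hD]
    beta_reduce
    have hi : ∀ s, IntervalIntegrable (fun x => f s x * Real.sin (w * x) ^ 2) volume a b :=
      fun s => ((hft s).mul hs).intervalIntegrable _ _
    rw [← intervalIntegral.integral_sub (hi t) (hi 0), ← Real.norm_eq_abs]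
    have hDi : IntervalIntegrable (fun x => |f t x - f 0 x|) volume a b :=
      ((hft t).sub (hft 0)).abs.intervalIntegrable _ _
    refine intervalIntegral.norm_integral_le_of_norm_le hab (ae_of_all _ fun x _ => ?_) hDi
    rw [← sub_mul, Real.norm_eq_abs, abs_mul, abs_of_nonneg (sq_nonneg (Real.sin (w * x)))]
    exact mul_le_of_le_one_right (abs_nonneg _) (Real.sin_sq_le_one _)
  have hrate : Tendsto (fun w : ℝ => 2 * w ^ 2) atTop atTop :=
    (tendsto_pow_atTop two_ne_zero).const_mul_atTop two_pos
  have hlap : ∀ h : ℝ → ℝ, Continuous h → Tendsto (fun w : ℝ =>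
      w ^ 2 * ∫ t in (0:ℝ)..T, Real.exp (-(2 * w ^ 2) * t) * h t) atTop
      (nhds ((1 / 2) * h 0)) := by
    intro h hh
    refine (((tendsto_mul_integral_exp_neg_mul hT hh.continuousOn).comp hrate).const_mul
      (1 / 2)).congr fun w => ?_
    simp only [Function.comp_apply]
    ring
  have hmain : Tendsto (fun w : ℝ =>
      (w ^ 2 * ∫ t in (0:ℝ)..T, Real.exp (-(2 * w ^ 2) * t) * 1) * G w 0) atTop
      (nhds ((1 / 4) * ∫ x in a..b, f 0 x)) := by
    convert (hlap (fun _ => 1) continuous_const).mul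
      (tendsto_intervalIntegral_mul_sin_sq hab ((hft 0).intervalIntegrable a b)) using 2
    ring
  have herr : Tendsto (fun w : ℝ => w ^ 2 * ∫ t in (0:ℝ)..T,
      Real.exp (-(2 * w ^ 2) * t) * (G w t - G w 0)) atTop (nhds 0) := by
    have hD0 := hlap D hDc
    rw [show D 0 = 0 by simp [hD], mul_zero] at hD0
    refine squeeze_zero_norm (fun w => ?_) hD0
    rw [norm_mul, Real.norm_of_nonneg (sq_nonneg w)]
    refine mul_le_mul_of_nonneg_left ?_ (sq_nonneg w)
    refine intervalIntegral.norm_integral_le_of_norm_le hT.le (ae_of_all _ fun t _ => ?_)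
      ((by fun_prop : Continuous fun t => Real.exp (-(2 * w ^ 2) * t) * D t).intervalIntegrable
        _ _)
    rw [norm_mul, Real.norm_of_nonneg (Real.exp_pos _).le]
    exact mul_le_mul_of_nonneg_left (hGD w t) (Real.exp_pos _).le
  have hsum := hmain.add herr
  rw [add_zero] at hsum
  refine hsum.congr fun w => ?_
  have hGw := hGc w
  rw [mul_assoc, ← mul_add, ← intervalIntegral.integral_mul_const,
    ← intervalIntegral.integral_add
      (Continuous.intervalIntegrable (by fun_prop) _ _)
      (Continuous.intervalIntegrable (by fun_prop) _ _)]
  congr 2 with t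
  ring

/-- **The motivating two-scale/Laplace computation of Section 1.4.**
For `w_K(t,x) = θ(x) sin(Kx) e^(-K² t)` with `θ` continuous `2π`-periodic and
`φ` continuous on `[0,T] × ℝ`, `2π`-periodic in `x`, the rescaled measures
`K² w_K² dt dx` concentrate on `{t = 0}` with density `(1/4) θ(x)²`:
`K² ∬ θ(x)² sin(Kx)² e^(-2K²t) φ(t,x) → (1/4) ∫ θ(x)² φ(0,x) dx` as `K → ∞`. -/
theorem two_scale_laplace_concentration (T : ℝ) (hT : 0 < T)
    (θ : ℝ → ℝ) (hθc : Continuous θ) (hθp : Function.Periodic θ (2 * Real.pi))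
    (φ : ℝ → ℝ → ℝ)
    (hφc : ContinuousOn (fun p : ℝ × ℝ => φ p.1 p.2) (Set.Icc 0 T ×ˢ Set.univ))
    (hφp : ∀ t, Function.Periodic (φ t) (2 * Real.pi)) :
    Tendsto (fun K : ℕ =>
        (K : ℝ) ^ 2 * ∫ t in (0:ℝ)..T, ∫ x in (0:ℝ)..(2 * Real.pi),
          θ x ^ 2 * Real.sin ((K : ℝ) * x) ^ 2 * Real.exp (-2 * (K : ℝ) ^ 2 * t) * φ t x)
      atTop
      (nhds ((1 / 4) * ∫ x in (0:ℝ)..(2 * Real.pi), θ x ^ 2 * φ 0 x)) := by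
  set f : ℝ → ℝ → ℝ := fun t x => θ x ^ 2 * φ (max 0 (min T t)) x with hfdef
  have hf : Continuous fun p : ℝ × ℝ => f p.1 p.2 := by
    have hclamp : Continuous fun p : ℝ × ℝ => φ (max 0 (min T p.1)) p.2 :=
      hφc.comp_continuous (f := fun p : ℝ × ℝ => (max 0 (min T p.1), p.2)) (by fun_prop)
        fun p => ⟨⟨le_max_left _ _, max_le hT.le (min_le_left _ _)⟩, trivial⟩
    exact ((hθc.comp continuous_snd).pow 2).mul hclamp
  have h := (tendsto_sq_mul_integral_exp_mul_sin_sq hT two_pi_pos.le hf).comp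
    tendsto_natCast_atTop_atTop
  have hf0 : f 0 = fun x => θ x ^ 2 * φ 0 x := by simp [hfdef, hT.le]
  rw [hf0] at h
  refine h.congr fun K => ?_
  simp only [Function.comp_apply]
  congr 1
  refine intervalIntegral.integral_congr fun t ht => ?_
  rw [Set.uIcc_of_le hT.le] at ht
  rw [← intervalIntegral.integral_const_mul]
  congr 1 with x
  simp only [hfdef, min_eq_right ht.2, max_eq_right ht.1, neg_mul]
  ring
end
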